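/- Jordan–Wigner transform: for j : Fin n, let X_j, Y_j, Z_j denote the Pauli matrices X = [[0,1],[1,0]], Y = [[0,−i],[i,0]], Z = [[1,0],[0,−1]] acting on the j-th tensor factor of (ℂ²)^{⊗n} (modeled as complex matrices indexed by Fin n → Bool, identity on the other factors), and define a_j := (∏_{l < j} Z_l) * (X_j + i·Y_j)/2. Then the canonical anticommutation relations hold: for all j, k : Fin n, (i) a_j * a_k + a_k * a_j = 0; (ii) a_jᴴ * a_kᴴ + a_kᴴ * a_jᴴ = 0; (iii) a_j * a_kᴴ + a_kᴴ * a_j = if j = k then 1 else 0, where ᴴ denotes the conjugate transpose and 1 the identity matrix. -/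

import Mathlib

open Matrix

namespace BooleanFourier

/-- A single-qubit matrix `σ` acting on the `j`-th qubit of `n` qubits (identity elsewhere). -/
def onQubit {n : ℕ} (σ : Matrix Bool Bool ℂ) (j : Fin n) :
    Matrix (Fin n → Bool) (Fin n → Bool) ℂ :=
  Matrix.of fun x y =>
    σ (x j) (y j) * ∏ l ∈ Finset.univ.filter (fun l : Fin n => l ≠ j),
      (if x l = y l then (1 : ℂ) else 0)

/-- The Pauli `X` matrix. -/
def Xb : Matrix Bool Bool ℂ := Matrix.of fun a b => if a ≠ b then 1 else 0

/-- The Pauli `Y` matrix. -/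
def Yb : Matrix Bool Bool ℂ :=
  Matrix.of fun a b => if a then (if b then 0 else Complex.I) else (if b then -Complex.I else 0)

/-- The Pauli `Z` matrix. -/
def Zb : Matrix Bool Bool ℂ := Matrix.of fun a b => if a = b then (if a then -1 else 1) else 0

/-- The Jordan–Wigner annihilation operator
`a_j = (∏_{l<j} Z_l) (X_j + i Y_j)/2` on `n` qubits. -/
noncomputable def jwA {n : ℕ} (j : Fin n) : Matrix (Fin n → Bool) (Fin n → Bool) ℂ :=
  (((Finset.univ.filter (fun l : Fin n => l < j)).sort (· ≤ ·)).map
      (fun l => onQubit Zb l)).prod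
    * ((2 : ℂ)⁻¹ • (onQubit Xb j + Complex.I • onQubit Yb j))

/-- The tensor product of a family of single-qubit matrices. -/
def tensor {n : ℕ} (f : Fin n → Matrix Bool Bool ℂ) :
    Matrix (Fin n → Bool) (Fin n → Bool) ℂ :=
  Matrix.of fun x y => ∏ l, f l (x l) (y l)

theorem tensor_mul {n : ℕ} (f g : Fin n → Matrix Bool Bool ℂ) :
    tensor f * tensor g = tensor (f * g) := by
  ext x y
  simp only [tensor, Matrix.mul_apply, Matrix.of_apply, Pi.mul_apply, Fintype.prod_sum,
    Finset.prod_mul_distrib]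

theorem tensor_conjTranspose {n : ℕ} (f : Fin n → Matrix Bool Bool ℂ) :
    (tensor f)ᴴ = tensor fun l => (f l)ᴴ := by
  ext x y
  simp [tensor, Matrix.conjTranspose_apply]

theorem tensor_one {n : ℕ} : tensor (1 : Fin n → Matrix Bool Bool ℂ) = 1 := by
  ext x y
  simp [tensor, Matrix.one_apply, Fintype.prod_ite_zero, funext_iff]

theorem onQubit_eq_tensor {n : ℕ} (σ : Matrix Bool Bool ℂ) (j : Fin n) :
    onQubit σ j = tensor (Pi.mulSingle j σ) := by
  ext x y
  simp only [onQubit, tensor, Matrix.of_apply]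
  rw [← Finset.mul_prod_erase Finset.univ _ (Finset.mem_univ j), Pi.mulSingle_eq_same,
    Finset.filter_ne']
  congr 1
  refine Finset.prod_congr rfl fun l hl => ?_
  rw [Pi.mulSingle_eq_of_ne (Finset.ne_of_mem_erase hl), Matrix.one_apply]

theorem onQubit_add {n : ℕ} (σ τ : Matrix Bool Bool ℂ) (j : Fin n) :
    onQubit (σ + τ) j = onQubit σ j + onQubit τ j := by
  ext x y
  simp [onQubit, add_mul]

theorem onQubit_smul {n : ℕ} (c : ℂ) (σ : Matrix Bool Bool ℂ) (j : Fin n) :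
    onQubit (c • σ) j = c • onQubit σ j := by
  ext x y
  simp [onQubit, mul_assoc]

theorem onQubit_one {n : ℕ} (j : Fin n) : onQubit 1 j = 1 := by
  rw [onQubit_eq_tensor, Pi.mulSingle_one, tensor_one]

theorem prod_map_onQubit {n : ℕ} (σ : Matrix Bool Bool ℂ) (L : List (Fin n)) :
    (L.map fun l => onQubit σ l).prod = tensor fun l => σ ^ L.count l := by
  induction L with
  | nil =>
    simp only [List.map_nil, List.prod_nil, List.count_nil, pow_zero]
    exact tensor_one.symm
  | cons a L ih =>
    rw [List.map_cons, List.prod_cons, ih, onQubit_eq_tensor, tensor_mul]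
    congr 1
    funext l
    by_cases h : l = a
    · subst h
      simp [pow_succ']
    · simp [h, Ne.symm h]

/-- Tensor products anticommute if their factors anticommute at one site and commute at all
others. -/
theorem tensor_anticomm {n : ℕ} {f g : Fin n → Matrix Bool Bool ℂ} (j : Fin n)
    (hj : f j * g j = -(g j * f j)) (h : ∀ l ≠ j, f l * g l = g l * f l) :
    tensor f * tensor g + tensor g * tensor f = 0 := by
  rw [tensor_mul, tensor_mul]
  ext x y
  simp only [tensor, Matrix.add_apply, Matrix.of_apply, Matrix.zero_apply, Pi.mul_apply]
  rw [← Finset.mul_prod_erase Finset.univ _ (Finset.mem_univ j),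
    ← Finset.mul_prod_erase Finset.univ (fun l => (g l * f l) (x l) (y l)) (Finset.mem_univ j),
    hj, Finset.prod_congr rfl fun l hl => by rw [h l (Finset.ne_of_mem_erase hl)]]
  simp

/-- The single-qubit lowering matrix `(X + i Y)/2`. -/
noncomputable def lowering : Matrix Bool Bool ℂ := (2 : ℂ)⁻¹ • (Xb + Complex.I • Yb)

theorem lowering_apply (a b : Bool) : lowering a b = if !a && b then 1 else 0 := by
  cases a <;> cases b <;> norm_num [lowering, Xb, Yb]

theorem lowering_mul_self : lowering * lowering = 0 := by
  ext a b
  cases a <;> cases b <;> simp [Matrix.mul_apply, lowering_apply]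

theorem lowering_mul_conjTranspose_add :
    lowering * loweringᴴ + loweringᴴ * lowering = 1 := by
  ext a b
  cases a <;> cases b <;> simp [Matrix.mul_apply, lowering_apply]

theorem Zb_mul_self : Zb * Zb = 1 := by
  ext a b
  cases a <;> cases b <;> simp [Matrix.mul_apply, Zb]

theorem Zb_conjTranspose : Zbᴴ = Zb := by
  ext a b
  cases a <;> cases b <;> simp [Zb]

theorem lowering_mul_Zb : lowering * Zb = -(Zb * lowering) := by
  ext a b
  cases a <;> cases b <;> simp [Matrix.mul_apply, lowering_apply, Zb]

theorem conjTranspose_lowering_mul_Zb : loweringᴴ * Zb = -(Zb * loweringᴴ) := by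
  ext a b
  cases a <;> cases b <;> simp [Matrix.mul_apply, lowering_apply, Zb]

/-- The tensor factors of a Jordan–Wigner string: `Z` before site `j`, `σ` at `j`, the identity
after `j`. -/
def jwString {n : ℕ} (σ : Matrix Bool Bool ℂ) (j l : Fin n) : Matrix Bool Bool ℂ :=
  if l < j then Zb else if l = j then σ else 1

theorem jwA_eq_tensor {n : ℕ} (j : Fin n) : jwA j = tensor (jwString lowering j) := by
  rw [jwA, prod_map_onQubit, ← onQubit_smul, ← onQubit_add, ← onQubit_smul, onQubit_eq_tensor,
    tensor_mul]
  congr 1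
  funext l
  have hc : ((Finset.univ.filter (fun l : Fin n => l < j)).sort (· ≤ ·)).count l =
      if l < j then 1 else 0 := by
    rw [(Finset.sort_nodup _ _).count]
    simp
  simp only [Pi.mul_apply, hc, jwString]
  rcases lt_trichotomy l j with h | rfl | h
  · simp [h, h.ne]
  · simp [lowering]
  · simp [h.not_gt, h.ne']

theorem jwA_conjTranspose_eq_tensor {n : ℕ} (j : Fin n) :
    (jwA j)ᴴ = tensor (jwString loweringᴴ j) := by
  rw [jwA_eq_tensor, tensor_conjTranspose]
  congr 1
  funext l
  simp only [jwString]
  split_ifs <;> simp [Zb_conjTranspose]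

theorem tensor_jwString_anticomm_of_lt {n : ℕ} {σ : Matrix Bool Bool ℂ}
    (τ : Matrix Bool Bool ℂ) (hσ : σ * Zb = -(Zb * σ)) {j k : Fin n} (hjk : j < k) :
    tensor (jwString σ j) * tensor (jwString τ k)
      + tensor (jwString τ k) * tensor (jwString σ j) = 0 := by
  refine tensor_anticomm j ?_ fun l hl => ?_
  · simp [jwString, hjk, hσ]
  · rcases hl.lt_or_gt with h | h
    · simp [jwString, h, h.trans hjk]
    · simp [jwString, h.not_gt, hl]

theorem tensor_jwString_anticomm_of_ne {n : ℕ} {σ τ : Matrix Bool Bool ℂ}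
    (hσ : σ * Zb = -(Zb * σ)) (hτ : τ * Zb = -(Zb * τ)) {j k : Fin n} (hjk : j ≠ k) :
    tensor (jwString σ j) * tensor (jwString τ k)
      + tensor (jwString τ k) * tensor (jwString σ j) = 0 := by
  rcases hjk.lt_or_gt with h | h
  · exact tensor_jwString_anticomm_of_lt τ hσ h
  · rw [add_comm]
    exact tensor_jwString_anticomm_of_lt σ hτ h

theorem tensor_jwString_mul_same {n : ℕ} (σ τ : Matrix Bool Bool ℂ) (j : Fin n) :
    tensor (jwString σ j) * tensor (jwString τ j) = onQubit (σ * τ) j := by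
  rw [tensor_mul, onQubit_eq_tensor]
  congr 1
  funext l
  rcases lt_trichotomy l j with h | rfl | h
  · simp [jwString, h, h.ne, Zb_mul_self]
  · simp [jwString]
  · simp [jwString, h.not_gt, h.ne']

theorem jwA_anticomm {n : ℕ} (j k : Fin n) : jwA j * jwA k + jwA k * jwA j = 0 := by
  simp only [jwA_eq_tensor]
  by_cases h : j = k
  · subst h
    rw [tensor_jwString_mul_same, ← onQubit_add, lowering_mul_self, add_zero]
    ext x y
    simp [onQubit]
  · exact tensor_jwString_anticomm_of_ne lowering_mul_Zb lowering_mul_Zb h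

/-- The Jordan–Wigner operators satisfy the canonical anticommutation relations. -/
theorem jordan_wigner_car {n : ℕ} (j k : Fin n) :
    (jwA j * jwA k + jwA k * jwA j = 0)
    ∧ ((jwA j)ᴴ * (jwA k)ᴴ + (jwA k)ᴴ * (jwA j)ᴴ = 0)
    ∧ (jwA j * (jwA k)ᴴ + (jwA k)ᴴ * jwA j = if j = k then 1 else 0) := by
  refine ⟨jwA_anticomm j k, ?_, ?_⟩
  · simpa [add_comm] using congrArg Matrix.conjTranspose (jwA_anticomm j k)
  · rw [jwA_conjTranspose_eq_tensor, jwA_eq_tensor]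
    split_ifs with h
    · subst h
      rw [tensor_jwString_mul_same, tensor_jwString_mul_same, ← onQubit_add,
        lowering_mul_conjTranspose_add, onQubit_one]
    · exact tensor_jwString_anticomm_of_ne lowering_mul_Zb conjTranspose_lowering_mul_Zb h

end BooleanFourier
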